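/- Let K be an algebraically closed field of characteristic 0 and let d ≥ 4. Any nonsingular homogeneous polynomial F ∈ K[X,Y,Z] of degree d whose automorphism group Aut(F) contains an element of order d²−3d+3 is projectively equivalent to the Klein curve K_d : X^{d−1}·Y + Y^{d−1}·Z + Z^{d−1}·X. -/

import Mathlib

open MvPolynomial Matrix

noncomputable section

variable {K : Type*} [Field K]

/-- The substitution `F ∘ A`, i.e. `X i ↦ ∑ j, A i j • X j`. -/
def substPoly (A : Matrix (Fin 3) (Fin 3) K) (F : MvPolynomial (Fin 3) K) :
    MvPolynomial (Fin 3) K :=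
  aeval (fun i => ∑ j, A i j • X j) F

lemma substPoly_one (F : MvPolynomial (Fin 3) K) : substPoly 1 F = F := by
  have h : (fun i => ∑ j, (1 : Matrix (Fin 3) (Fin 3) K) i j • X j)
      = (X : Fin 3 → MvPolynomial (Fin 3) K) := by
    funext i
    simp [Matrix.one_apply, ite_smul]
  rw [substPoly, h]
  exact aeval_X_left_apply F

lemma substPoly_smul (A : Matrix (Fin 3) (Fin 3) K) (c : K) (F : MvPolynomial (Fin 3) K) :
    substPoly A (c • F) = c • substPoly A F := by
  unfold substPoly
  exact _root_.map_smul (aeval fun i => ∑ j, A i j • X j) c F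

lemma substPoly_mul (A B : Matrix (Fin 3) (Fin 3) K) (F : MvPolynomial (Fin 3) K) :
    substPoly (A * B) F = substPoly B (substPoly A F) := by
  have hfun : (fun i => ∑ j, (A * B) i j • (X j : MvPolynomial (Fin 3) K))
      = fun i => (aeval fun i => (∑ j, B i j • X j : MvPolynomial (Fin 3) K))
          (∑ j, A i j • X j : MvPolynomial (Fin 3) K) := by
    funext i
    rw [map_sum]
    simp only [_root_.map_smul, aeval_X, Matrix.mul_apply, Finset.sum_smul, Finset.smul_sum, smul_smul]
    exact Finset.sum_comm
  have h1 : substPoly (A * B) F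
      = aeval (fun i => (aeval fun i => (∑ j, B i j • X j : MvPolynomial (Fin 3) K))
          (∑ j, A i j • X j : MvPolynomial (Fin 3) K)) F := by
    unfold substPoly
    exact congrArg
      (fun f => (aeval f : MvPolynomial (Fin 3) K →ₐ[K] MvPolynomial (Fin 3) K) F) hfun
  rw [h1, ← MvPolynomial.comp_aeval]
  rfl

/-- The subgroup of `GL₃(K)` preserving the polynomial `F` up to scalar. -/
def autGL (F : MvPolynomial (Fin 3) K) : Subgroup (GL (Fin 3) K) where
  carrier := {A | ∃ c : Kˣ, substPoly (A : Matrix (Fin 3) (Fin 3) K) F = (c : K) • F}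
  one_mem' := ⟨1, by simp [substPoly_one]⟩
  mul_mem' := by
    rintro A B ⟨c, hc⟩ ⟨e, he⟩
    refine ⟨c * e, ?_⟩
    have hAB : ((A * B : GL (Fin 3) K) : Matrix (Fin 3) (Fin 3) K)
        = (A : Matrix (Fin 3) (Fin 3) K) * (B : Matrix (Fin 3) (Fin 3) K) := rfl
    rw [hAB, substPoly_mul, hc, substPoly_smul, he, smul_smul, ← Units.val_mul]
  inv_mem' := by
    rintro A ⟨c, hc⟩
    refine ⟨c⁻¹, ?_⟩
    have key : (c : K) • substPoly ((A⁻¹ : GL (Fin 3) K) : Matrix (Fin 3) (Fin 3) K) F = F := by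
      rw [← substPoly_smul, ← hc, ← substPoly_mul]
      have h1 : (A : Matrix (Fin 3) (Fin 3) K) *
          ((A⁻¹ : GL (Fin 3) K) : Matrix (Fin 3) (Fin 3) K) = 1 := by
        exact_mod_cast Units.mul_inv A
      rw [h1, substPoly_one]
    calc substPoly ((A⁻¹ : GL (Fin 3) K) : Matrix (Fin 3) (Fin 3) K) F
        = ((c : K)⁻¹ * (c : K)) •
            substPoly ((A⁻¹ : GL (Fin 3) K) : Matrix (Fin 3) (Fin 3) K) F := by
          rw [inv_mul_cancel₀ (Units.ne_zero c), one_smul]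
      _ = (c : K)⁻¹ • ((c : K) •
            substPoly ((A⁻¹ : GL (Fin 3) K) : Matrix (Fin 3) (Fin 3) K) F) := by
          rw [smul_smul]
      _ = (c : K)⁻¹ • F := by rw [key]
      _ = ((c⁻¹ : Kˣ) : K) • F := by rw [Units.val_inv_eq_inv_val]

/-- `PGL₃(K)`: the quotient of `GL₃(K)` by its center (the scalar matrices). -/
abbrev PGL3 (K : Type*) [Field K] := GL (Fin 3) K ⧸ Subgroup.center (GL (Fin 3) K)

/-- The automorphism group of the plane curve `F = 0`, as a subgroup of `PGL₃(K)`: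
the classes of matrices `A` with `F ∘ A = λ • F` for some `λ ∈ Kˣ`. -/
def projAut (F : MvPolynomial (Fin 3) K) : Subgroup (PGL3 K) :=
  (autGL F).map (QuotientGroup.mk' (Subgroup.center (GL (Fin 3) K)))

/-- `F` is nonsingular: the only common zero of its partial derivatives is the origin. -/
def IsNonsingular (F : MvPolynomial (Fin 3) K) : Prop :=
  ∀ x : Fin 3 → K, (∀ i, eval x (pderiv i F) = 0) → x = 0

/-- `F` and `G` are projectively equivalent: `F ∘ A = λ • G` for some `A ∈ GL₃(K)`, `λ ∈ Kˣ`. -/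
def ProjEquiv (F G : MvPolynomial (Fin 3) K) : Prop :=
  ∃ A : GL (Fin 3) K, ∃ c : Kˣ,
    substPoly (A : Matrix (Fin 3) (Fin 3) K) F = (c : K) • G


theorem powN_arith {m x y z N : ℕ} (hm : 3 ≤ m) (hN : N + m = m * m + 1) (hs : x + y + z = m + 1)
    (h : m * x + y ≡ m [MOD N]) : (x = m ∧ y = 1 ∧ z = 0) ∨ (x = 0 ∧ y = m ∧ z = 1) ∨
      (x = 1 ∧ y = 0 ∧ z = m) := by
  have hNm : m < N := by nlinarith
  obtain ⟨t, ht⟩ : ∃ t, m * x + y = m + N * t := by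
    by_cases hle : m ≤ m * x + y
    · obtain ⟨t, ht⟩ := (Nat.modEq_iff_dvd' hle).1 h.symm
      exact ⟨t, by omega⟩
    · exfalso
      have := (Nat.modEq_iff_dvd' (by omega : m * x + y ≤ m)).1 h
      have := Nat.le_of_dvd (by omega) this
      omega
  have ht2 : t < 2 := by
    by_contra hcon
    have h1 : N * 2 ≤ N * t := Nat.mul_le_mul_left _ (by omega)
    have h2 : m * x + y ≤ m * (m + 1) := by nlinarith
    nlinarith
  interval_cases t
  · have hx : x < 2 := by
      by_contra hcon
      have : m * 2 ≤ m * x := Nat.mul_le_mul_left _ (by omega)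
      omega
    interval_cases x
    · right; left; omega
    · right; right; omega
  · left
    have h1 : m * x + y = m * m + 1 := by omega
    have hx : m ≤ x := by
      by_contra hcon
      obtain ⟨k, rfl⟩ : ∃ k, m = x + 1 + k := ⟨m - (x + 1), by omega⟩
      nlinarith
    have hx2 : x ≤ m := by
      by_contra hcon
      have : x = m + 1 := by omega
      subst this
      nlinarith
    have : x = m := by omega
    subst this
    omega

section
variable {K : Type*} [Field K]

theorem pow_mul_l {a b : K} {n : ℕ} (h : a ^ n = b ^ n) (k : ℕ) : a ^ (n * k) = b ^ (n * k) := by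
  rw [pow_mul, pow_mul, h]
theorem pow_mul_r {a b : K} {n : ℕ} (h : a ^ n = b ^ n) (k : ℕ) : a ^ (k * n) = b ^ (k * n) := by
  rw [mul_comm, pow_mul_l h]

variable {a b c l : K} {m N : ℕ}

theorem L1 (ha : a ^ m * a = l) (hb : b ^ m * b = l) (hc : c ^ m * c = l) :
    a ^ (m + 1) = b ^ (m + 1) ∧ b ^ (m + 1) = c ^ (m + 1) := by
  simp only [pow_succ, ha, hb, hc, and_self]

theorem L2 (a0 : a ≠ 0) (ha : a ^ m * a = l) (hb : b ^ m * b = l) (hc : c ^ m * a = l) :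
    a ^ ((m + 1) * m) = b ^ ((m + 1) * m) ∧ b ^ ((m + 1) * m) = c ^ ((m + 1) * m) := by
  have h1 : a ^ (m + 1) = b ^ (m + 1) := by simp only [pow_succ, ha, hb]
  have h2 : a ^ m = c ^ m := mul_right_cancel₀ a0 (ha.trans hc.symm)
  exact ⟨pow_mul_l h1 _, (pow_mul_l h1 _).symm.trans (pow_mul_r h2 _)⟩

theorem L3a (a0 : a ≠ 0) (ha : a ^ m * a = l) (hb : b ^ m * a = l) (hc : c ^ m * a = l) :
    a ^ m = b ^ m ∧ b ^ m = c ^ m :=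
  ⟨mul_right_cancel₀ a0 (ha.trans hb.symm), mul_right_cancel₀ a0 (hb.trans hc.symm)⟩

theorem L3b (a0 : a ≠ 0) (ha : a ^ m * a = l) (hb : b ^ m * a = l) (hc : c ^ m * b = l) :
    a ^ (m * m) = b ^ (m * m) ∧ b ^ (m * m) = c ^ (m * m) := by
  have h1 : a ^ m = b ^ m := mul_right_cancel₀ a0 (ha.trans hb.symm)
  have h2 : a ^ (m * m) = c ^ (m * m) := by
    have : (a ^ m * a) ^ m = (c ^ m * b) ^ m := by rw [ha, hc]
    rw [mul_pow, mul_pow, ← h1, ← pow_mul, ← pow_mul] at this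
    exact mul_right_cancel₀ (pow_ne_zero _ a0) this
  exact ⟨pow_mul_l h1 _, (pow_mul_l h1 _).symm.trans h2⟩

theorem Laux {k : ℕ} (b0 : b ≠ 0) (c0 : c ≠ 0)
    (hb : b ^ (k + 1) * c = l) (hc : c ^ (k + 1) * b = l) : b ^ k = c ^ k := by
  have : b ^ k * (b * c) = c ^ k * (b * c) := by
    rw [← mul_assoc, ← pow_succ, hb, mul_comm b c, ← mul_assoc, ← pow_succ, hc]
  exact mul_right_cancel₀ (mul_ne_zero b0 c0) this

theorem L3c {k : ℕ} (b0 : b ≠ 0) (c0 : c ≠ 0) (ha : a ^ (k + 1) * a = l)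
    (hb : b ^ (k + 1) * c = l) (hc : c ^ (k + 1) * b = l) :
    a ^ ((k + 2) * k) = b ^ ((k + 2) * k) ∧ b ^ ((k + 2) * k) = c ^ ((k + 2) * k) := by
  have h := Laux b0 c0 hb hc
  refine ⟨?_, pow_mul_r h _⟩
  rw [pow_mul, pow_succ, ha, ← hb, mul_pow, ← h, ← pow_mul, ← pow_add]
  ring_nf

theorem L4 {k : ℕ} (a0 : a ≠ 0) (b0 : b ≠ 0) (ha : a ^ (k + 1) * b = l)
    (hb : b ^ (k + 1) * a = l) (hc : c ^ (k + 1) * a = l) :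
    a ^ ((k + 1) * k) = b ^ ((k + 1) * k) ∧ b ^ ((k + 1) * k) = c ^ ((k + 1) * k) := by
  have h := Laux a0 b0 ha hb
  have h2 : b ^ (k + 1) = c ^ (k + 1) := mul_right_cancel₀ a0 (hb.trans hc.symm)
  exact ⟨pow_mul_r h _, pow_mul_l h2 _⟩

/-- Only the two three-cycles survive. -/
theorem cycle_cases (a : Fin 3 → K) (a0 : ∀ i, a i ≠ 0) (hm : 3 ≤ m) (hN : N + m = m * m + 1)
    (H : ∀ n, a 0 ^ n = a 1 ^ n → a 1 ^ n = a 2 ^ n → N ∣ n)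
    (f : Fin 3 → Fin 3) (hf : ∀ i, a i ^ m * a (f i) = l) :
    ∃ σ : Equiv.Perm (Fin 3), ∀ i, f (σ i) = σ (i + 1) := by
  have H' : ∀ i j k : Fin 3, i ≠ j → j ≠ k → i ≠ k → ∀ n,
      a i ^ n = a j ^ n ∧ a j ^ n = a k ^ n → N ∣ n := by
    intro i j k hij hjk hik n hn
    apply H <;> fin_cases i <;> fin_cases j <;> fin_cases k <;> simp_all
  have key : ∀ n q r, n = N * q + r → 0 < r → r < N → ¬ N ∣ n := by
    rintro n q r rfl h0 h1 h2
    have := (Nat.dvd_add_right (Dvd.intro q rfl)).1 h2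
    exact absurd (Nat.le_of_dvd h0 this) (by omega)
  obtain ⟨k, rfl⟩ : ∃ k, m = k + 1 := ⟨m - 1, by omega⟩
  have n1 := key (k + 1 + 1) 0 (k + 2) (by ring) (by omega) (by nlinarith)
  have n2 := key ((k + 1 + 1) * (k + 1)) 1 (2 * k + 1) (by nlinarith) (by omega) (by nlinarith)
  have n3 := key (k + 1) 0 (k + 1) (by ring) (by omega) (by nlinarith)
  have n4 := key ((k + 1) * (k + 1)) 1 k (by nlinarith) (by omega) (by nlinarith)
  have n5 := key ((k + 2) * k) 1 (k - 1) (by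
    obtain ⟨j, rfl⟩ : ∃ j, k = j + 1 := ⟨k - 1, by omega⟩
    simp; nlinarith) (by omega) (by have : k - 1 ≤ k := Nat.sub_le _ _; nlinarith)
  have n6 : ¬ N ∣ (k + 1) * k := by
    intro hd
    have e : N = (k + 1) * k + 1 := by nlinarith
    exact absurd (Nat.le_of_dvd (by nlinarith) hd) (by omega)
  have c1 : ¬ (f 0 = 0 ∧ f 1 = 1 ∧ f 2 = 2) := by
    rintro ⟨h0, h1, h2⟩
    refine n1 (H' 0 1 2 (by decide) (by decide) (by decide) _ (L1 (l := l) ?_ ?_ ?_))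
    · simpa [h0] using hf 0
    · simpa [h1] using hf 1
    · simpa [h2] using hf 2
  have gen : ∀ i j k : Fin 3, i ≠ j → j ≠ k → i ≠ k →
      ¬ (f i = i ∧ f j = j ∧ f k = i) ∧ ¬ (f i = i ∧ f j = i ∧ f k = i) ∧
      ¬ (f i = i ∧ f j = i ∧ f k = j) ∧ ¬ (f i = i ∧ f j = k ∧ f k = j) ∧
      ¬ (f i = j ∧ f j = i ∧ f k = i) := by
    intro i j k hij hjk hik
    have hi := hf i
    have hj := hf j
    have hk := hf k
    refine ⟨?_, ?_, ?_, ?_, ?_⟩ <;> rintro ⟨h0, h1, h2⟩ <;> rw [h0] at hi <;> rw [h1] at hj <;>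
      rw [h2] at hk
    · exact n2 (H' i j k hij hjk hik _ (L2 (a0 _) hi hj hk))
    · exact n3 (H' i j k hij hjk hik _ (L3a (a0 _) hi hj hk))
    · exact n4 (H' i j k hij hjk hik _ (L3b (a0 _) hi hj hk))
    · exact n5 (H' i j k hij hjk hik _ (L3c (a0 _) (a0 _) hi hj hk))
    · exact n6 (H' i j k hij hjk hik _ (L4 (a0 _) (a0 _) hi hj hk))
  have fin : (f 0 = 1 ∧ f 1 = 2 ∧ f 2 = 0) ∨ (f 0 = 2 ∧ f 2 = 1 ∧ f 1 = 0) := by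
    have g1 := gen 0 1 2 (by decide) (by decide) (by decide)
    have g2 := gen 0 2 1 (by decide) (by decide) (by decide)
    have g3 := gen 1 0 2 (by decide) (by decide) (by decide)
    have g4 := gen 1 2 0 (by decide) (by decide) (by decide)
    have g5 := gen 2 0 1 (by decide) (by decide) (by decide)
    have g6 := gen 2 1 0 (by decide) (by decide) (by decide)
    clear gen hf H H' key n1 n2 n3 n4 n5 n6 hm hN a0
    generalize f 0 = x at *
    generalize f 1 = y at *
    generalize f 2 = z at *
    fin_cases x <;> fin_cases y <;> fin_cases z <;> simp_all
  rcases fin with ⟨h0, h1, h2⟩ | ⟨h0, h1, h2⟩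
  · refine ⟨1, fun i => ?_⟩
    fin_cases i
    · exact h0
    · exact h1
    · exact h2
  · refine ⟨Equiv.swap 1 2, fun i => ?_⟩
    fin_cases i
    · exact h0
    · exact h1
    · exact h2

end

section
variable {K : Type*} [Field K]

theorem exists_eigenbasis [IsAlgClosed K] [CharZero K] (A : Matrix (Fin 3) (Fin 3) K) (N : ℕ)
    (hN : N ≠ 0) (c : K) (hc : c ≠ 0) (h : A ^ N = c • (1 : Matrix (Fin 3) (Fin 3) K)) :
    ∃ (P : GL (Fin 3) K) (a : Fin 3 → K), A * P.1 = P.1 * Matrix.diagonal a := by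
  classical
  have hss : Module.End.IsSemisimple (Matrix.toLin' A) := by
    refine Module.End.isSemisimple_of_squarefree_aeval_eq_zero
      (p := Polynomial.X ^ N - Polynomial.C c)
      (Polynomial.separable_X_pow_sub_C c (by exact_mod_cast hN) hc).squarefree ?_
    simp only [map_sub, map_pow, Polynomial.aeval_X, Polynomial.aeval_C]
    rw [← Matrix.toLin'_pow, h]
    ext; simp [Module.algebraMap_end_apply]
  have hint := DirectSum.isInternal_submodule_of_iSupIndep_of_iSup_eq_top
    (Module.End.eigenspaces_iSupIndep (Matrix.toLin' A)) hss.iSup_eigenspace_eq_top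
  let b := hint.collectedBasis (fun μ => Module.finBasis K (Module.End.eigenspace (Matrix.toLin' A) μ))
  have : Fintype (Σ μ : K, Fin (Module.finrank K (Module.End.eigenspace (Matrix.toLin' A) μ))) :=
    FiniteDimensional.fintypeBasisIndex b
  have hcard : Fintype.card (Σ μ : K, Fin (Module.finrank K
      (Module.End.eigenspace (Matrix.toLin' A) μ))) = Fintype.card (Fin 3) := by
    rw [← Module.finrank_eq_card_basis b]; simp
  let e := Fintype.equivOfCardEq hcard
  let b' := b.reindex e
  have hb : ∀ i, A *ᵥ (b' i) = (e.symm i).1 • b' i := by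
    intro i
    have := hint.collectedBasis_mem
      (fun μ => Module.finBasis K (Module.End.eigenspace (Matrix.toLin' A) μ)) (e.symm i)
    rw [Module.End.mem_eigenspace_iff, Matrix.toLin'_apply] at this
    simpa [b', b] using this
  let P : Matrix (Fin 3) (Fin 3) K := Matrix.of fun r i => b' i r
  have hP : IsUnit P := by
    rw [← Matrix.linearIndependent_cols_iff_isUnit]
    exact b'.linearIndependent
  refine ⟨hP.unit, fun i => (e.symm i).1, ?_⟩
  ext r i
  rw [Matrix.mul_diagonal]
  have := congrFun (hb i) r
  simp only [Pi.smul_apply, smul_eq_mul] at this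
  rw [mul_comm]
  exact this

theorem pderiv_substPoly (A : Matrix (Fin 3) (Fin 3) K) (F : MvPolynomial (Fin 3) K) (i : Fin 3) :
    pderiv i (substPoly A F) = ∑ j, A j i • substPoly A (pderiv j F) := by
  induction F using MvPolynomial.induction_on with
  | C r => simp [substPoly]
  | add p q hp hq =>
    simp only [substPoly, map_add, smul_add, Finset.sum_add_distrib] at hp hq ⊢
    rw [hp, hq]
  | mul_X p k hp =>
    simp only [substPoly, map_mul, Derivation.leibniz, map_add, smul_eq_mul, aeval_X, pderiv_X] at hp ⊢
    rw [hp]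
    have h1 : (pderiv i) (∑ j, A k j • (X j : MvPolynomial (Fin 3) K)) = C (A k i) := by
      rw [map_sum]
      simp only [Derivation.map_smul, pderiv_X]
      rw [Finset.sum_eq_single i]
      · simp [smul_eq_C_mul]
      · intro b _ hb; simp [Pi.single_apply, hb]
      · simp
    rw [h1]
    have h2 : ∀ j : Fin 3, (aeval fun i => ∑ j, A i j • (X j : MvPolynomial (Fin 3) K))
        (Pi.single (M := fun _ => MvPolynomial (Fin 3) K) j 1 k) = if k = j then 1 else 0 := by
      intro j
      by_cases hkj : k = j <;> simp [Pi.single_apply, hkj]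
    simp only [h2, smul_add, Finset.sum_add_distrib]
    congr 1
    · simp [smul_eq_C_mul, mul_comm]
    · rw [Finset.mul_sum]
      exact Finset.sum_congr rfl fun j _ => by rw [mul_smul_comm]

theorem eval_substPoly (A : Matrix (Fin 3) (Fin 3) K) (F : MvPolynomial (Fin 3) K) (x : Fin 3 → K) :
    eval x (substPoly A F) = eval (A *ᵥ x) F := by
  induction F using MvPolynomial.induction_on with
  | C r => simp [substPoly]
  | add p q hp hq =>
    simp only [substPoly, map_add] at hp hq ⊢
    rw [hp, hq]
  | mul_X p k hp =>
    simp only [substPoly, map_mul, aeval_X, eval_X] at hp ⊢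
    rw [hp]
    congr 1
    simp [Matrix.mulVec, dotProduct, smul_eval]

theorem nonsing_subst (P : GL (Fin 3) K) (F : MvPolynomial (Fin 3) K) (h : IsNonsingular F) :
    IsNonsingular (substPoly P.1 F) := by
  intro x hx
  have h1 : P.1 *ᵥ x = 0 := by
    apply h
    have h2 : P.1ᵀ *ᵥ (fun j => eval (P.1 *ᵥ x) (pderiv j F)) = 0 := by
      funext i
      have := hx i
      rw [pderiv_substPoly, map_sum] at this
      simp only [smul_eval, eval_substPoly] at this
      simpa [Matrix.mulVec, dotProduct] using this
    have hu : IsUnit P.1ᵀ := (Matrix.isUnit_transpose _).2 P.isUnit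
    have := Matrix.mulVec_injective_of_isUnit hu (h2.trans (Matrix.mulVec_zero _).symm)
    intro i
    exact congrFun this i
  exact Matrix.mulVec_injective_of_isUnit P.isUnit (h1.trans (Matrix.mulVec_zero _).symm)

theorem hom_subst (A : Matrix (Fin 3) (Fin 3) K) (F : MvPolynomial (Fin 3) K) (d : ℕ)
    (h : F.IsHomogeneous d) : (substPoly A F).IsHomogeneous d := by
  have := h.aeval (φ := F) (n := 1) (fun i => ∑ j, A i j • (X j : MvPolynomial (Fin 3) K)) ?_
  · simpa [substPoly] using this
  · intro i
    refine IsHomogeneous.sum _ _ _ fun j _ => ?_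
    rw [smul_eq_C_mul]
    simpa using (isHomogeneous_C (Fin 3) (A i j)).mul (isHomogeneous_X K j)

theorem coeff_subst_diag (a : Fin 3 → K) (F : MvPolynomial (Fin 3) K) (s : Fin 3 →₀ ℕ) :
    coeff s (substPoly (Matrix.diagonal a) F) = (∏ i, a i ^ s i) * coeff s F := by
  induction F using MvPolynomial.induction_on' with
  | monomial u r =>
    have : substPoly (Matrix.diagonal a) (monomial u r) = monomial u ((∏ i, a i ^ u i) * r) := by
      have h1 : (fun i => ∑ j, Matrix.diagonal a i j • (X j : MvPolynomial (Fin 3) K))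
          = fun i => C (a i) * X i := by
        funext i
        simp [Matrix.diagonal_apply, ite_smul, smul_eq_C_mul]
      rw [substPoly, h1, aeval_monomial, monomial_eq, Finsupp.prod_fintype _ _ (by simp), Finsupp.prod_fintype _ _ (by simp)]
      simp only [mul_pow, Finset.prod_mul_distrib, map_mul, map_prod, map_pow, algebraMap_eq]
      ring
    rw [this, coeff_monomial, coeff_monomial]
    split_ifs with hu
    · rw [hu]
    · simp
  | add p q hp hq =>
    have : substPoly (Matrix.diagonal a) (p + q)
      = substPoly (Matrix.diagonal a) p + substPoly (Matrix.diagonal a) q := by simp [substPoly]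
    rw [this, coeff_add, coeff_add, hp, hq, mul_add]

theorem exists_coeff (G : MvPolynomial (Fin 3) K) (m : ℕ) (hG : G.IsHomogeneous (m + 1))
    (h : IsNonsingular G) (i : Fin 3) :
    ∃ j, coeff (Finsupp.single i m + Finsupp.single j 1) G ≠ 0 := by
  by_contra! hcon
  have hx := h (Pi.single i 1) ?_
  · have := congrFun hx i
    simp at this
  intro j
  conv_lhs => rw [G.as_sum]
  rw [map_sum, map_sum]
  refine Finset.sum_eq_zero fun s hs => ?_
  rw [pderiv_monomial, eval_monomial]
  by_cases hj : s j = 0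
  · simp [hj]
  by_cases hk : ∃ k, k ≠ i ∧ (s - Finsupp.single j 1 : Fin 3 →₀ ℕ) k ≠ 0
  · obtain ⟨k, hki, hk⟩ := hk
    rw [Finsupp.prod_fintype _ _ (by simp)]
    rw [Finset.prod_eq_zero (Finset.mem_univ k), mul_zero]
    rw [Pi.single_eq_of_ne hki, zero_pow hk]
  · push Not at hk
    exfalso
    apply mem_support_iff.1 hs
    rw [← hcon j]
    congr 1
    have hdeg : s 0 + s 1 + s 2 = m + 1 := by
      have := hG (mem_support_iff.1 hs)
      simpa [Finsupp.weight_apply, Finsupp.sum_fintype, Fin.sum_univ_three] using this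
    have h0 := hk 0
    have h1 := hk 1
    have h2 := hk 2
    ext k
    fin_cases i <;> fin_cases j <;> fin_cases k <;>
      simp [Finsupp.single_apply] at h0 h1 h2 hj ⊢ <;> omega
end

section
variable {K : Type*} [Field K]

theorem support_cases {m N : ℕ} (hm : 3 ≤ m) (hN : N + m = m * m + 1) (b : Fin 3 → K)
    (b0 : ∀ i, b i ≠ 0) (l : K) (hb : ∀ i, b i ^ m * b (i + 1) = l)
    (H : ∀ n, b 0 ^ n = b 1 ^ n → b 1 ^ n = b 2 ^ n → N ∣ n) (x y z : ℕ) (hs : x + y + z = m + 1)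
    (h : b 0 ^ x * b 1 ^ y * b 2 ^ z = l) :
    (x = m ∧ y = 1 ∧ z = 0) ∨ (x = 0 ∧ y = m ∧ z = 1) ∨ (x = 1 ∧ y = 0 ∧ z = m) := by
  apply powN_arith hm hN hs
  have h1 : b 1 ^ m * b 2 = l := hb 1
  have h2 : b 2 ^ m * b 0 = l := hb 2
  have n2 := b0 2
  let u : Kˣ := Units.mk0 (b 1 / b 2) (div_ne_zero (b0 1) (b0 2))
  have hu : (u : K) = b 1 / b 2 := rfl
  have e1 : b 1 = u * b 2 := by rw [hu]; field_simp
  have e0 : b 0 = (u : K) ^ m * b 2 := by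
    have : b 2 ^ m * b 0 = b 2 ^ m * ((u : K) ^ m * b 2) := by
      rw [h2, ← h1, e1]; ring
    exact mul_left_cancel₀ (pow_ne_zero _ n2) this
  have hord : N ∣ orderOf u := by
    have hp : (u : K) ^ orderOf u = 1 := by
      rw [← Units.val_pow_eq_pow_val, pow_orderOf_eq_one]; rfl
    have hq : ((u : K) ^ m) ^ orderOf u = 1 := by rw [← pow_mul, mul_comm, pow_mul, hp, one_pow]
    apply H
    · rw [e0, e1, mul_pow, mul_pow, hp, hq]
    · rw [e1, mul_pow, hp, one_mul]
  refine Nat.ModEq.of_dvd hord (pow_eq_pow_iff_modEq.1 ?_)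
  apply Units.ext
  push_cast
  have : (u : K) ^ (m * x + y) * b 2 ^ (m + 1) = (u : K) ^ m * b 2 ^ (m + 1) := by
    have r : (u : K) ^ m * b 2 ^ (m + 1) = l := by rw [← h1, e1]; ring
    rw [r, ← h, ← hs, e0, e1]
    ring
  exact mul_right_cancel₀ (pow_ne_zero _ n2) this

theorem exists_scale [IsAlgClosed K] {m : ℕ} (hm : 3 ≤ m) (c : Fin 3 → K) (hc : ∀ p, c p ≠ 0) :
    ∃ (t : Fin 3 → K) (κ : K), (∀ p, t p ≠ 0) ∧ κ ≠ 0 ∧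
      ∀ p, c p * (t p ^ m * t (p + 1)) = κ := by
  obtain ⟨k, rfl⟩ : ∃ k, m = k + 1 := ⟨m - 1, by omega⟩
  have h0 := hc 0
  have h1 := hc 1
  have h2 := hc 2
  obtain ⟨t, ht⟩ := IsAlgClosed.exists_pow_nat_eq (c 2 / c 0 * (c 2 / c 1) ^ k)
    (n := (k + 1) * k + 1) (by omega)
  have ht0 : t ≠ 0 := by
    rintro rfl
    rw [zero_pow (by omega)] at ht
    exact (mul_ne_zero (div_ne_zero h2 h0) (pow_ne_zero _ (div_ne_zero h2 h1))) ht.symm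
  set t0 : K := t ^ (k + 1) * (c 1 / c 2) with ht0'
  have ht00 : t0 ≠ 0 := mul_ne_zero (pow_ne_zero _ ht0) (div_ne_zero h1 h2)
  have key : c 0 * (t0 ^ k * t) = c 2 := by
    have e : t0 ^ k * t = t ^ ((k + 1) * k + 1) * (c 1 / c 2) ^ k := by
      rw [ht0', mul_pow, ← pow_mul]; ring
    rw [e, ht, mul_assoc, ← mul_pow]
    have : c 2 / c 1 * (c 1 / c 2) = 1 := by field_simp
    rw [this, one_pow]
    field_simp
  refine ⟨![t0, t, 1], c 2 * t0, ?_, mul_ne_zero h2 ht00, ?_⟩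
  · intro p; fin_cases p
    · exact ht00
    · exact ht0
    · exact one_ne_zero
  · intro p; fin_cases p
    · change c 0 * (t0 ^ (k + 1) * t) = c 2 * t0
      rw [← key]; ring
    · change c 1 * (t ^ (k + 1) * 1) = c 2 * t0
      rw [ht0']; field_simp
    · change c 2 * (1 ^ (k + 1) * t0) = c 2 * t0
      rw [one_pow, one_mul]

theorem scale_perm (σ : Equiv.Perm (Fin 3)) (t : Fin 3 → K) (ht : ∀ p, t p ≠ 0) :
    ∃ B : GL (Fin 3) K, ∀ p, ∑ j, B.1 (σ p) j • (X j : MvPolynomial (Fin 3) K) = C (t p) * X p := by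
  classical
  let M : Matrix (Fin 3) (Fin 3) K := Matrix.of fun i j => if σ j = i then t j else 0
  let M' : Matrix (Fin 3) (Fin 3) K := Matrix.of fun j i => if σ j = i then (t j)⁻¹ else 0
  have h : M' * M = 1 := by
    ext i j
    simp only [M, M', Matrix.mul_apply, Matrix.of_apply, Matrix.one_apply]
    rw [Finset.sum_eq_single (σ i)]
    · by_cases hij : i = j
      · subst hij; simp [ht]
      · have : ¬ j = i := fun h => hij h.symm
        simp [hij, this]
    · intro k _ hk
      rw [if_neg (fun h => hk h.symm), zero_mul]
    · simp
  refine ⟨⟨M, M', mul_eq_one_comm.1 h, h⟩, fun p => ?_⟩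
  simp only [M, Matrix.of_apply]
  rw [Finset.sum_eq_single p]
  · simp [smul_eq_C_mul]
  · intro j _ hj
    simp [hj]
  · simp

theorem klein_of_cycle [IsAlgClosed K] {m : ℕ} (hm : 3 ≤ m) (σ : Equiv.Perm (Fin 3))
    (G : MvPolynomial (Fin 3) K)
    (hc : ∀ p, coeff (Finsupp.single (σ p) m + Finsupp.single (σ (p + 1)) 1) G ≠ 0)
    (hs : ∀ s, coeff s G ≠ 0 → ∃ p, s = Finsupp.single (σ p) m + Finsupp.single (σ (p + 1)) 1) :
    ProjEquiv G (X 0 ^ m * X 1 + X 1 ^ m * X 2 + X 2 ^ m * X 0) := by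
  classical
  obtain ⟨t, κ, ht, hκ, htκ⟩ := exists_scale hm _ hc
  obtain ⟨B, hB⟩ := scale_perm σ t ht
  refine ⟨B, Units.mk0 κ hκ, ?_⟩
  set S : Fin 3 → (Fin 3 →₀ ℕ) :=
    fun p => Finsupp.single (σ p) m + Finsupp.single (σ (p + 1)) 1 with hS
  have hinj : Function.Injective S := by
    intro p q hpq
    by_contra hne
    have := DFunLike.congr_fun hpq (σ p)
    have hne' : ¬ q = p := fun h => hne h.symm
    simp only [hS, Finsupp.add_apply, Finsupp.single_apply, σ.injective.eq_iff, hne', if_true,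
      if_false] at this
    split_ifs at this <;> omega
  have hG : G = ∑ p, monomial (S p) (coeff (S p) G) := by
    conv_lhs => rw [G.as_sum]
    rw [← Finset.sum_image (s := Finset.univ) (g := S) (f := fun s => monomial s (coeff s G))
      (fun p _ q _ h => hinj h)]
    apply Finset.sum_subset
    · intro s hs'
      obtain ⟨p, hp⟩ := hs s (mem_support_iff.1 hs')
      exact Finset.mem_image.2 ⟨p, Finset.mem_univ _, hp.symm⟩
    · intro s _ hs'
      rw [notMem_support_iff.1 hs', monomial_zero]
  have hmono : ∀ p, substPoly B.1 (monomial (S p) (coeff (S p) G))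
      = κ • (X p ^ m * X (p + 1)) := by
    intro p
    have e : monomial (S p) (coeff (S p) G)
        = C (coeff (S p) G) * (X (σ p) ^ m * X (σ (p + 1))) := by
      rw [X_pow_eq_monomial, X, monomial_mul, C_mul_monomial]; simp [hS]
    rw [e, substPoly]
    simp only [map_mul, map_pow, aeval_X, hB, aeval_C, algebraMap_eq]
    rw [← htκ p, smul_eq_C_mul]
    simp only [map_mul, map_pow, S]
    ring
  have hsum : substPoly B.1 G = ∑ p, κ • (X p ^ m * X (p + 1)) := by
    conv_lhs => rw [hG]
    rw [substPoly, map_sum]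
    exact Finset.sum_congr rfl fun p _ => hmono p
  change substPoly B.1 G = κ • _
  rw [hsum, ← Finset.smul_sum, Fin.sum_univ_three]
  rfl

theorem diag_case [IsAlgClosed K] {m N : ℕ} (hm : 3 ≤ m) (hN : N + m = m * m + 1) (a : Fin 3 → K)
    (a0 : ∀ i, a i ≠ 0) (G : MvPolynomial (Fin 3) K) (hG : G.IsHomogeneous (m + 1))
    (hns : IsNonsingular G) (l : K) (hl : substPoly (Matrix.diagonal a) G = l • G)
    (H : ∀ n, (∀ i j, a i ^ n = a j ^ n) → N ∣ n) :
    ProjEquiv G (X 0 ^ m * X 1 + X 1 ^ m * X 2 + X 2 ^ m * X 0) := by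
  have hw : ∀ s, coeff s G ≠ 0 → ∏ i, a i ^ s i = l := by
    intro s hs
    have := congrArg (coeff s) hl
    rw [coeff_subst_diag, coeff_smul, smul_eq_mul] at this
    exact mul_right_cancel₀ hs this
  choose f hf using exists_coeff G m hG hns
  have hfw : ∀ i, a i ^ m * a (f i) = l := by
    intro i
    rw [← hw _ (hf i)]
    simp only [Finsupp.add_apply, pow_add, Finset.prod_mul_distrib]
    congr 1
    · rw [Finset.prod_eq_single i]
      · simp
      · intro j _ hj; simp [Finsupp.single_apply, hj.symm]
      · simp
    · rw [Finset.prod_eq_single (f i)]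
      · simp
      · intro j _ hj; simp [Finsupp.single_apply, hj.symm]
      · simp
  obtain ⟨σ, hσ⟩ := cycle_cases a a0 hm hN (fun n h1 h2 => H n (by
    intro i j; fin_cases i <;> fin_cases j <;> simp [h1, h2])) f hfw
  refine klein_of_cycle hm σ G (fun p => ?_) (fun s hs => ?_)
  · rw [← hσ]; exact hf _
  · have hdeg : ∑ i, s i = m + 1 := by
      have := hG hs
      simpa [Finsupp.weight_apply, Finsupp.sum_fintype] using this
    rw [← Equiv.sum_comp σ, Fin.sum_univ_three] at hdeg
    have hp := hw s hs
    rw [← Equiv.prod_comp σ, Fin.prod_univ_three] at hp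
    have hcases := support_cases hm hN (fun p => a (σ p)) (fun p => a0 _) l
      (fun p => by rw [← hσ]; exact hfw _)
      (fun n h1 h2 => H n (by
        have : ∀ p q, a (σ p) ^ n = a (σ q) ^ n := by
          intro i j
          fin_cases i <;> fin_cases j <;> simp [h1, h2]
        intro i j
        simpa using this (σ.symm i) (σ.symm j))) _ _ _ hdeg hp
    have hext : ∀ p, (∀ q, s (σ q) = (if q = p then m else 0) + (if q = p + 1 then 1 else 0)) →
        s = Finsupp.single (σ p) m + Finsupp.single (σ (p + 1)) 1 := by
      intro p h
      ext i
      obtain ⟨q, rfl⟩ := σ.surjective i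
      rw [h]
      simp only [Finsupp.add_apply, Finsupp.single_apply, σ.injective.eq_iff, eq_comm]
    rcases hcases with ⟨h0, h1, h2⟩ | ⟨h0, h1, h2⟩ | ⟨h0, h1, h2⟩
    · refine ⟨0, hext 0 fun q => ?_⟩
      fin_cases q <;> simp [h0, h1, h2]
    · refine ⟨1, hext 1 fun q => ?_⟩
      fin_cases q <;> simp [h0, h1, h2]
    · refine ⟨2, hext 2 fun q => ?_⟩
      fin_cases q <;> simp [h0, h1, h2]
end

/-- any nonsingular plane curve of degree `d ≥ 4` with an automorphism of
order `d²-3d+3` is projectively equivalent to the Klein curve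
`X^(d-1)·Y + Y^(d-1)·Z + Z^(d-1)·X`. -/
theorem stmt7 {K : Type*} [Field K] [IsAlgClosed K] [CharZero K]
    (d : ℕ) (hd : 4 ≤ d) (F : MvPolynomial (Fin 3) K)
    (hhom : F.IsHomogeneous d) (hns : IsNonsingular F)
    (h : ∃ g ∈ projAut F, orderOf g = d * d - 3 * d + 3) :
    ProjEquiv F (X 0 ^ (d - 1) * X 1 + X 1 ^ (d - 1) * X 2 + X 2 ^ (d - 1) * X 0) := by
  obtain ⟨g, ⟨A, ⟨l, hl⟩, rfl⟩, hord⟩ := h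
  obtain ⟨m, rfl⟩ : ∃ m, d = m + 1 := ⟨d - 1, by omega⟩
  have hm : 3 ≤ m := by omega
  set N := (m + 1) * (m + 1) - 3 * (m + 1) + 3 with hNdef
  have hN : N + m = m * m + 1 := by
    have : 3 * (m + 1) ≤ (m + 1) * (m + 1) := Nat.mul_le_mul_right _ (by omega)
    have e : (m + 1) * (m + 1) = m * m + 2 * m + 1 := by ring
    omega
  have hN0 : N ≠ 0 := by omega
  have hcen : ∀ n, N ∣ n ↔ ∃ c : K, Matrix.scalar (Fin 3) c = A.1 ^ n := by
    intro n
    rw [← hord, orderOf_dvd_iff_pow_eq_one, ← map_pow, ← MonoidHom.mem_ker, QuotientGroup.ker_mk',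
      Matrix.GeneralLinearGroup.mem_center_iff_val_mem_range_scalar, ← Units.val_pow_eq_pow_val]
    rfl
  obtain ⟨c, hc⟩ := (hcen N).1 dvd_rfl
  have hc0 : c ≠ 0 := by
    rintro rfl
    have hu : IsUnit (A.1 ^ N) := A.isUnit.pow N
    rw [← hc, map_zero] at hu
    exact not_isUnit_zero hu
  obtain ⟨P, a, hP⟩ := exists_eigenbasis A.1 N hN0 c hc0 (by
    rw [← hc, Matrix.smul_one_eq_diagonal]; rfl)
  have a0 : ∀ i, a i ≠ 0 := by
    have hdet := congrArg Matrix.det hP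
    rw [Matrix.det_mul, Matrix.det_mul, Matrix.det_diagonal, mul_comm] at hdet
    have hPd : P.1.det ≠ 0 := ((Matrix.isUnit_iff_isUnit_det _).1 P.isUnit).ne_zero
    have hAd : A.1.det ≠ 0 := ((Matrix.isUnit_iff_isUnit_det _).1 A.isUnit).ne_zero
    have := mul_left_cancel₀ hPd hdet
    rw [this] at hAd
    intro i
    exact Finset.prod_ne_zero_iff.1 hAd i (Finset.mem_univ i)
  have hG : substPoly (Matrix.diagonal a) (substPoly P.1 F) = (l : K) • substPoly P.1 F := by
    rw [← substPoly_mul, ← hP, substPoly_mul]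
    rw [show substPoly A.1 F = (l : K) • F from hl, substPoly_smul]
  obtain ⟨B, κ, hB⟩ := diag_case hm hN a a0 (substPoly P.1 F) (hom_subst _ _ _ hhom)
    (nonsing_subst P F hns) l hG (fun n hn => by
      rw [hcen]
      refine ⟨a 0 ^ n, ?_⟩
      have hs : SemiconjBy P.1 (Matrix.diagonal a) A.1 := hP.symm
      have h1 : P.1 * Matrix.diagonal a ^ n = A.1 ^ n * P.1 := hs.pow_right n
      have h2 : Matrix.diagonal a ^ n = Matrix.scalar (Fin 3) (a 0 ^ n) := by
        rw [Matrix.diagonal_pow, Matrix.scalar_apply]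
        congr 1
        funext i
        exact hn i 0
      rw [h2, ← (Matrix.scalar_commute (a 0 ^ n) (fun r => mul_comm _ _) P.1).eq] at h1
      exact P.isUnit.mul_right_cancel h1)
  refine ⟨P * B, κ, ?_⟩
  rw [Nat.add_sub_cancel, ← hB]
  exact substPoly_mul P.1 B.1 F

end
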